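/- Let μ and μ' be two quasi-stationary Markov measures on K_N, associated to (λ, T) and (λ', T') respectively. Then either μ and μ' are equivalent (mutually absolutely continuous), or μ and μ' are mutually singular. -/

import Mathlib

open MeasureTheory Filter Finset

/-- `IsMarkov μ l T` means that `μ` is the Markov measure on `K_N = ℕ → Fin N`
associated to the probability vector `l` and the sequence of transition matrices `T`
(with `T n` playing the role of `T^(n+1)` of the paper, and words indexed from `0`):
for every cylinder set determined by the first `n + 1` letters,
`μ(C(w₀ … w_n)) = l_{w₀} T^(1)_{w₀,w₁} ⋯ T^(n)_{w_{n-1},w_n}`. -/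
def IsMarkov {N : ℕ} (μ : Measure (ℕ → Fin N)) (l : Fin N → ℝ)
    (T : ℕ → Matrix (Fin N) (Fin N) ℝ) : Prop :=
  ∀ (n : ℕ) (w : ℕ → Fin N),
    μ {x | ∀ k ≤ n, x k = w k} =
      ENNReal.ofReal (l (w 0) * ∏ k ∈ Finset.range n, T k (w k) (w (k + 1)))

/-- Overwrite the letters of index `≤ n` of an infinite word by a finite word. -/
def overwrite {α : Type*} {n : ℕ} (u : Finset.Iic n → α) (x : ℕ → α) : ℕ → α :=
  fun k => if h : k ≤ n then u ⟨k, Finset.mem_Iic.2 h⟩ else x k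

lemma overwrite_of_le {α : Type*} {n k : ℕ} (u : Finset.Iic n → α) (x : ℕ → α) (h : k ≤ n) :
    overwrite u x k = u ⟨k, Finset.mem_Iic.2 h⟩ := dif_pos h

lemma overwrite_of_lt {α : Type*} {n k : ℕ} (u : Finset.Iic n → α) (x : ℕ → α) (h : n < k) :
    overwrite u x k = x k := dif_neg (not_le.2 h)

lemma overwrite_frestrictLe_self {α : Type*} (n : ℕ) (x : ℕ → α) :
    overwrite (Preorder.frestrictLe (π := fun _ => α) n x) x = x := by
  funext k
  rcases le_or_gt k n with h | h
  · rw [overwrite_of_le _ _ h]; rfl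
  · rw [overwrite_of_lt _ _ h]

lemma measurable_overwrite {α : Type*} [MeasurableSpace α] {n : ℕ} (u : Finset.Iic n → α) :
    Measurable (overwrite u) := by
  refine measurable_pi_lambda _ fun k => ?_
  rcases le_or_gt k n with h | h
  · simp only [overwrite_of_le _ _ h, measurable_const]
  · simpa only [overwrite_of_lt _ _ h] using measurable_pi_apply k

lemma frestrictLe_preimage_singleton {α : Type*} (n : ℕ) (w : ℕ → α) :
    Preorder.frestrictLe (π := fun _ => α) n ⁻¹' {Preorder.frestrictLe (π := fun _ => α) n w} =
      {x | ∀ k ≤ n, x k = w k} := by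
  ext x
  simp [funext_iff]

lemma measurableSet_prefix {N : ℕ} (n : ℕ) (w : ℕ → Fin N) :
    MeasurableSet {x : ℕ → Fin N | ∀ k ≤ n, x k = w k} := by
  rw [← frestrictLe_preimage_singleton]
  exact Preorder.measurable_frestrictLe n (measurableSet_singleton _)

/-- Two measures comparable on cylinders of a given length are comparable on
all sets determined by that many letters. -/
lemma measure_preimage_frestrictLe_mono {N : ℕ} {ν μ : Measure (ℕ → Fin N)} (n : ℕ)
    (h : ∀ w : ℕ → Fin N, ν {x | ∀ k ≤ n, x k = w k} ≤ μ {x | ∀ k ≤ n, x k = w k})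
    (D : Set (Finset.Iic n → Fin N)) :
    ν (Preorder.frestrictLe n ⁻¹' D) ≤ μ (Preorder.frestrictLe n ⁻¹' D) := by
  have hm : Measurable (Preorder.frestrictLe (π := fun _ : ℕ => Fin N) n) :=
    Preorder.measurable_frestrictLe n
  lift D to Finset (Finset.Iic n → Fin N) using Set.toFinite D
  rw [← sum_measure_preimage_singleton D fun _ _ => hm (measurableSet_singleton _),
    ← sum_measure_preimage_singleton D fun _ _ => hm (measurableSet_singleton _)]
  refine Finset.sum_le_sum fun u _ => ?_
  by_cases hu : ∃ w : ℕ → Fin N, Preorder.frestrictLe n w = u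
  · obtain ⟨w, rfl⟩ := hu
    simpa only [frestrictLe_preimage_singleton] using h w
  · have : Preorder.frestrictLe (π := fun _ : ℕ => Fin N) n ⁻¹' {u} = ∅ :=
      Set.eq_empty_of_forall_notMem fun w hw => hu ⟨w, hw⟩
    simp [this]

/-- Two measures comparable on all long enough cylinders are comparable. -/
lemma measure_le_of_prefix {N : ℕ} {ν μ : Measure (ℕ → Fin N)} [IsFiniteMeasure μ] (n₀ : ℕ)
    (h : ∀ n, n₀ ≤ n → ∀ w : ℕ → Fin N,
      ν {x | ∀ k ≤ n, x k = w k} ≤ μ {x | ∀ k ≤ n, x k = w k}) : ν ≤ μ := by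
  have hopen : ∀ U : Set (ℕ → Fin N), IsOpen U → ν U ≤ μ U := by
    intro U hU
    let V : ℕ → Set (ℕ → Fin N) := fun n => {x | {y | ∀ k ≤ n, y k = x k} ⊆ U}
    have hVmono : Monotone V := fun m n hmn x hx y hy => hx fun k hk => hy k (hk.trans hmn)
    have hVle : ∀ n, V n ⊆ U := fun n x hx => hx fun k _ => rfl
    have hUV : U = ⋃ n, V (n₀ + n) := by
      refine Set.Subset.antisymm (fun x hx => ?_) (Set.iUnion_subset fun n => hVle _)
      obtain ⟨t, ⟨w, n, rfl⟩, hxt, htU⟩ :=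
        (PiNat.isTopologicalBasis_cylinders (fun _ : ℕ => Fin N)).exists_subset_of_mem_open hx hU
      refine Set.mem_iUnion.2 ⟨n, fun y hy => htU fun k hk => ?_⟩
      exact (hy k (by omega)).trans (hxt k hk)
    have hVpre : ∀ n, V n = Preorder.frestrictLe n ⁻¹' (Preorder.frestrictLe n '' V n) := by
      intro n
      refine Set.Subset.antisymm (Set.subset_preimage_image _ _) ?_
      rintro x ⟨y, hy, hyx⟩ z hz
      refine hy fun k hk => (hz k hk).trans ?_
      exact (congrFun hyx ⟨k, Finset.mem_Iic.2 hk⟩).symm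
    have hmono : Monotone fun n => V (n₀ + n) := fun a b hab => hVmono (by omega)
    rw [hUV, hmono.measure_iUnion, hmono.measure_iUnion]
    refine iSup_mono fun n => ?_
    rw [hVpre]
    exact measure_preimage_frestrictLe_mono _ (h _ (by omega)) _
  refine Measure.le_intro fun s _ _ => ?_
  rw [s.measure_eq_iInf_isOpen μ]
  exact le_iInf₂ fun U hsU => le_iInf fun hU => (measure_mono hsU).trans (hopen U hU)

lemma exists_pos_le_of_summable_div {a : ℕ → ℝ} (ha : ∀ n, 0 < a n)
    (hs : Summable fun n => |a n / a (n + 1) - 1|) : ∃ δ > 0, ∀ n, δ ≤ a n := by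
  refine ⟨a 0 * Real.exp (-∑' n, |a n / a (n + 1) - 1|), mul_pos (ha 0) (Real.exp_pos _), ?_⟩
  have key : ∀ n, a 0 * Real.exp (-∑ k ∈ Finset.range n, |a k / a (k + 1) - 1|) ≤ a n := by
    intro n
    induction n with
    | zero => simp
    | succ n ih =>
      rw [Finset.sum_range_succ, neg_add, Real.exp_add, ← mul_assoc]
      refine (mul_le_mul_of_nonneg_right ih (Real.exp_pos _).le).trans ?_
      rw [Real.exp_neg, ← div_eq_mul_inv, div_le_iff₀ (Real.exp_pos _), ← div_le_iff₀' (ha _)]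
      linarith [le_abs_self (a n / a (n + 1) - 1),
        Real.add_one_le_exp |a n / a (n + 1) - 1|]
  intro n
  refine le_trans ?_ (key n)
  gcongr
  · exact (ha 0).le
  · exact hs.sum_le_tsum _ fun _ _ => abs_nonneg _

/-- The entries of the transition matrices of a quasi-stationary Markov measure are
bounded away from zero. -/
lemma exists_pos_le_of_quasiStationary {N : ℕ} {T : ℕ → Matrix (Fin N) (Fin N) ℝ}
    (hpos : ∀ n i j, 0 < T n i j)
    (hqs : ∀ x : ℕ → Fin N,
      Summable fun n => |T n (x n) (x (n + 1)) / T (n + 1) (x n) (x (n + 1)) - 1|) :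
    ∃ δ > 0, ∀ n i j, δ ≤ T n i j := by
  have hentry : ∀ p : Fin N × Fin N, ∃ δ > 0, ∀ n, δ ≤ T n p.1 p.2 := by
    rintro ⟨i, j⟩
    refine exists_pos_le_of_summable_div (fun n => hpos n i j) ?_
    refine Summable.of_nonneg_of_le (fun _ => abs_nonneg _) (fun n => ?_)
      ((hqs fun n => if Even n then i else j).add (hqs fun n => if Even n then j else i))
    by_cases hn : Even n
    · simp [hn, Nat.even_add_one]
    · simp [hn, Nat.even_add_one]
  choose δ hδ hδT using hentry
  rcases isEmpty_or_nonempty (Fin N) with hN | hN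
  · exact ⟨1, one_pos, fun _ i => isEmptyElim i⟩
  · obtain ⟨p, hp⟩ := Finite.exists_min δ
    exact ⟨δ p, hδ p, fun n i j => (hp (i, j)).trans (hδT (i, j) n)⟩

namespace IsMarkov

variable {N : ℕ} {μ : Measure (ℕ → Fin N)} {l : Fin N → ℝ}
  {T : ℕ → Matrix (Fin N) (Fin N) ℝ} {δ : ℝ}

lemma measure_prefix_add (hμ : IsMarkov μ l T) (hl : ∀ i, 0 < l i) (hpos : ∀ n i j, 0 < T n i j)
    (n m : ℕ) (w : ℕ → Fin N) :
    μ {x | ∀ k ≤ n + 1 + m, x k = w k} =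
      μ {x | ∀ k ≤ n, x k = w k} * ENNReal.ofReal (T n (w n) (w (n + 1))) *
        ENNReal.ofReal (∏ k ∈ Finset.range m,
          T (n + 1 + k) (w (n + 1 + k)) (w (n + 1 + k + 1))) := by
  have h₀ : 0 ≤ l (w 0) * ∏ k ∈ Finset.range n, T k (w k) (w (k + 1)) :=
    mul_nonneg (hl _).le (Finset.prod_nonneg fun _ _ => (hpos _ _ _).le)
  rw [hμ, hμ, Finset.prod_range_add, Finset.prod_range_succ, ← ENNReal.ofReal_mul h₀,
    ← ENNReal.ofReal_mul (mul_nonneg h₀ (hpos _ _ _).le)]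
  congr 1
  ring

lemma measure_prefix_pos (hμ : IsMarkov μ l T) (hl : ∀ i, 0 < l i)
    (hpos : ∀ n i j, 0 < T n i j) (n : ℕ) (w : ℕ → Fin N) :
    0 < μ {x | ∀ k ≤ n, x k = w k} := by
  rw [hμ]
  exact ENNReal.ofReal_pos.2 (mul_pos (hl _) (Finset.prod_pos fun _ _ => hpos _ _ _))

variable [IsProbabilityMeasure μ]

/-- The letters after index `n` are almost independent of the first ones. -/
lemma measure_tail_le (hμ : IsMarkov μ l T) (hl : ∀ i, 0 < l i) (hpos : ∀ n i j, 0 < T n i j)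
    (hle : ∀ n i j, T n i j ≤ 1) (n m : ℕ) (w : ℕ → Fin N) :
    μ {x | ∀ k, n < k → k ≤ n + 1 + m → x k = w k} ≤
      ENNReal.ofReal (∏ k ∈ Finset.range m,
        T (n + 1 + k) (w (n + 1 + k)) (w (n + 1 + k + 1))) := by
  set E := {x : ℕ → Fin N | ∀ k, n < k → k ≤ n + 1 + m → x k = w k} with hE
  set R := ENNReal.ofReal (∏ k ∈ Finset.range m,
        T (n + 1 + k) (w (n + 1 + k)) (w (n + 1 + k + 1))) with hR
  have key := measure_preimage_frestrictLe_mono (ν := μ.restrict E) (μ := R • μ) n ?_ Set.univ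
  · simpa using key
  intro u
  let v : ℕ → Fin N := overwrite (Preorder.frestrictLe n u) w
  have hv : ∀ k ≤ n, v k = u k := fun k hk => overwrite_of_le _ _ hk
  have hv' : ∀ k, n < k → v k = w k := fun k hk => overwrite_of_lt _ _ hk
  have hset : {x : ℕ → Fin N | ∀ k ≤ n, x k = u k} ∩ E = {x | ∀ k ≤ n + 1 + m, x k = v k} := by
    ext x
    simp only [hE, Set.mem_inter_iff, Set.mem_ofPred_eq]
    constructor
    · rintro ⟨h₁, h₂⟩ k hk
      rcases le_or_gt k n with hkn | hkn
      · rw [h₁ k hkn, hv k hkn]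
      · rw [h₂ k hkn hk, hv' k hkn]
    · intro h
      exact ⟨fun k hk => by rw [h k (by omega), hv k hk],
        fun k hk hk' => by rw [h k hk', hv' k hk]⟩
  have hu : {x : ℕ → Fin N | ∀ k ≤ n, x k = v k} = {x | ∀ k ≤ n, x k = u k} := by
    ext x
    exact forall₂_congr fun k hk => by rw [hv k hk]
  have hRv : ENNReal.ofReal (∏ k ∈ Finset.range m,
        T (n + 1 + k) (v (n + 1 + k)) (v (n + 1 + k + 1))) = R := by
    rw [hR]
    congr 1
    exact Finset.prod_congr rfl fun k _ => by rw [hv' _ (by omega), hv' _ (by omega)]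
  rw [Measure.restrict_apply (measurableSet_prefix n u), hset,
    hμ.measure_prefix_add hl hpos, hRv, hu, Measure.smul_apply, smul_eq_mul, mul_comm R]
  gcongr
  exact mul_le_of_le_one_right' (ENNReal.ofReal_le_one.2 (hle _ _ _))

/-- Overwriting a prefix maps the Markov measure to a measure which it dominates. -/
lemma mul_measure_preimage_overwrite_le (hμ : IsMarkov μ l T) (hl : ∀ i, 0 < l i)
    (hpos : ∀ n i j, 0 < T n i j) (hle : ∀ n i j, T n i j ≤ 1) (hδ : ∀ n i j, δ ≤ T n i j)
    (n : ℕ) (w : ℕ → Fin N) {A : Set (ℕ → Fin N)} (hA : MeasurableSet A) :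
    ENNReal.ofReal δ * μ {x | ∀ k ≤ n, x k = w k} *
      μ (overwrite (Preorder.frestrictLe n w) ⁻¹' A) ≤ μ A := by
  set g : (ℕ → Fin N) → ℕ → Fin N := overwrite (Preorder.frestrictLe n w) with hg_def
  have hg : Measurable g := measurable_overwrite _
  suffices h : (ENNReal.ofReal δ * μ {x | ∀ k ≤ n, x k = w k}) • μ.map g ≤ μ by
    simpa [Measure.map_apply hg hA] using h A
  refine measure_le_of_prefix (n + 1) fun m hm v => ?_
  obtain ⟨m, rfl⟩ := Nat.exists_eq_add_of_le hm
  rw [Measure.smul_apply, smul_eq_mul, Measure.map_apply hg (measurableSet_prefix _ _)]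
  by_cases hvw : ∀ k ≤ n, v k = w k
  · have hsub : g ⁻¹' {x | ∀ k ≤ n + 1 + m, x k = v k} ⊆
        {x | ∀ k, n < k → k ≤ n + 1 + m → x k = v k} := fun x hx k hk hk' => by
      rw [← hx k hk', hg_def, overwrite_of_lt _ _ hk]
    have hw : {x : ℕ → Fin N | ∀ k ≤ n, x k = w k} = {x | ∀ k ≤ n, x k = v k} := by
      ext x
      exact forall₂_congr fun k hk => by rw [hvw k hk]
    rw [hμ.measure_prefix_add hl hpos, hw, mul_comm (ENNReal.ofReal δ)]
    exact mul_le_mul' (mul_le_mul_right (ENNReal.ofReal_le_ofReal (hδ _ _ _)) _)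
      ((measure_mono hsub).trans (hμ.measure_tail_le hl hpos hle n m v))
  · have hempty : g ⁻¹' {x | ∀ k ≤ n + 1 + m, x k = v k} = ∅ := by
      refine Set.eq_empty_of_forall_notMem fun x hx => hvw fun k hk => ?_
      rw [← hx k (by omega), hg_def, overwrite_of_le _ _ hk]
      rfl
    simp [hempty]

lemma measure_preimage_overwrite_eq_zero (hμ : IsMarkov μ l T) (hl : ∀ i, 0 < l i)
    (hpos : ∀ n i j, 0 < T n i j) (hle : ∀ n i j, T n i j ≤ 1) (hδ₀ : 0 < δ)
    (hδ : ∀ n i j, δ ≤ T n i j) {n : ℕ} (u : Finset.Iic n → Fin N) {A : Set (ℕ → Fin N)}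
    (hA : MeasurableSet A) (hA₀ : μ A = 0) : μ (overwrite u ⁻¹' A) = 0 := by
  rcases (overwrite u ⁻¹' A).eq_empty_or_nonempty with h | ⟨x, -⟩
  · simp [h]
  have hu : Preorder.frestrictLe n (overwrite u x) = u := by
    funext k
    exact overwrite_of_le u x (Finset.mem_Iic.1 k.2)
  have h := hμ.mul_measure_preimage_overwrite_le hl hpos hle hδ n (overwrite u x) hA
  rw [hA₀, hu, nonpos_iff_eq_zero, mul_eq_zero, mul_eq_zero] at h
  refine h.resolve_left (not_or.2 ⟨(ENNReal.ofReal_pos.2 hδ₀).ne', ?_⟩)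
  exact (hμ.measure_prefix_pos hl hpos n _).ne'

/-- Zero-one law for the events that do not depend on any finite set of letters. -/
lemma measure_compl_eq_zero (hμ : IsMarkov μ l T) (hl : ∀ i, 0 < l i)
    (hpos : ∀ n i j, 0 < T n i j) (hle : ∀ n i j, T n i j ≤ 1) (hδ₀ : 0 < δ)
    (hδ : ∀ n i j, δ ≤ T n i j) {S : Set (ℕ → Fin N)} (hS : MeasurableSet S)
    (hinv : ∀ (n : ℕ) (u : Finset.Iic n → Fin N), S ⊆ overwrite u ⁻¹' S)
    (hS₀ : μ S ≠ 0) : μ Sᶜ = 0 := by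
  have h : (ENNReal.ofReal δ * μ S) • μ ≤ μ.restrict S := by
    refine measure_le_of_prefix 0 fun n _ w => ?_
    rw [Measure.restrict_apply (measurableSet_prefix n w), Measure.smul_apply, smul_eq_mul,
      mul_right_comm]
    refine le_trans ?_ (hμ.mul_measure_preimage_overwrite_le hl hpos hle hδ n w
      ((measurableSet_prefix n w).inter hS))
    gcongr
    exact fun x hx => ⟨fun k hk => overwrite_of_le _ _ hk, hinv n _ hx⟩
  have h' := h Sᶜ
  rw [Measure.restrict_apply hS.compl, Set.compl_inter_self, measure_empty, Measure.smul_apply,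
    smul_eq_mul, nonpos_iff_eq_zero, mul_eq_zero, mul_eq_zero] at h'
  exact h'.resolve_left (not_or.2 ⟨(ENNReal.ofReal_pos.2 hδ₀).ne', hS₀⟩)

end IsMarkov

/-- The set of words that can be moved into `A` by overwriting a prefix. -/
def saturation {N : ℕ} (A : Set (ℕ → Fin N)) : Set (ℕ → Fin N) :=
  ⋃ (n : ℕ) (u : Finset.Iic n → Fin N), overwrite u ⁻¹' A

lemma measurableSet_saturation {N : ℕ} {A : Set (ℕ → Fin N)} (hA : MeasurableSet A) :
    MeasurableSet (saturation A) :=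
  .iUnion fun _ => .iUnion fun u => measurable_overwrite u hA

lemma subset_saturation {N : ℕ} (A : Set (ℕ → Fin N)) : A ⊆ saturation A := fun x hx =>
  Set.mem_iUnion₂.2 ⟨0, Preorder.frestrictLe 0 x, by
    rwa [Set.mem_preimage, overwrite_frestrictLe_self]⟩

lemma saturation_subset_preimage_overwrite {N : ℕ} (A : Set (ℕ → Fin N)) {n : ℕ}
    (u : Finset.Iic n → Fin N) : saturation A ⊆ overwrite u ⁻¹' saturation A := by
  intro x hx
  obtain ⟨m, v, hv⟩ := Set.mem_iUnion₂.1 hx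
  refine Set.mem_iUnion₂.2 ⟨max m n, Preorder.frestrictLe (max m n) (overwrite v x), ?_⟩
  have : overwrite (Preorder.frestrictLe (max m n) (overwrite v x)) (overwrite u x) =
      overwrite v x := by
    funext k
    rcases le_or_gt k (max m n) with hk | hk
    · rw [overwrite_of_le _ _ hk]
      rfl
    · rw [overwrite_of_lt _ _ hk, overwrite_of_lt _ _ (by omega), overwrite_of_lt _ _ (by omega)]
  rwa [Set.mem_preimage, this]

lemma IsMarkov.absolutelyContinuous_or_mutuallySingular {N : ℕ} {l l' : Fin N → ℝ}
    {T T' : ℕ → Matrix (Fin N) (Fin N) ℝ} {δ δ' : ℝ} {μ μ' : Measure (ℕ → Fin N)}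
    [IsProbabilityMeasure μ] [IsProbabilityMeasure μ']
    (hμ : IsMarkov μ l T) (hμ' : IsMarkov μ' l' T')
    (hl : ∀ i, 0 < l i) (hpos : ∀ n i j, 0 < T n i j) (hle : ∀ n i j, T n i j ≤ 1)
    (hδ₀ : 0 < δ) (hδ : ∀ n i j, δ ≤ T n i j)
    (hl' : ∀ i, 0 < l' i) (hpos' : ∀ n i j, 0 < T' n i j) (hle' : ∀ n i j, T' n i j ≤ 1)
    (hδ₀' : 0 < δ') (hδ' : ∀ n i j, δ' ≤ T' n i j) :
    μ ≪ μ' ∨ μ ⟂ₘ μ' := by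
  refine or_iff_not_imp_left.2 fun hac => ?_
  obtain ⟨A, hA, hA', hAμ⟩ : ∃ A, MeasurableSet A ∧ μ' A = 0 ∧ μ A ≠ 0 := by
    by_contra! hcon
    exact hac (Measure.AbsolutelyContinuous.mk hcon)
  have hS := measurableSet_saturation hA
  have hSμ : μ (saturation A)ᶜ = 0 :=
    hμ.measure_compl_eq_zero hl hpos hle hδ₀ hδ hS
      (fun _ u => saturation_subset_preimage_overwrite A u)
      fun h => hAμ (measure_mono_null (subset_saturation A) h)
  have hSμ' : μ' (saturation A) = 0 :=
    measure_iUnion_null fun _ => measure_iUnion_null fun u =>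
      hμ'.measure_preimage_overwrite_eq_zero hl' hpos' hle' hδ₀' hδ' u hA hA'
  exact ⟨(saturation A)ᶜ, hS.compl, hSμ, by rwa [compl_compl]⟩

lemma entry_le_one_of_row_sum {N : ℕ} {T : ℕ → Matrix (Fin N) (Fin N) ℝ}
    (hpos : ∀ n i j, 0 < T n i j) (hstoch : ∀ n i, ∑ j, T n i j = 1) (n : ℕ) (i j : Fin N) :
    T n i j ≤ 1 :=
  hstoch n i ▸ Finset.single_le_sum (fun k _ => (hpos n i k).le) (Finset.mem_univ j)

/-- dichotomy: Two quasi-stationary Markov measures are either equivalent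
(mutually absolutely continuous) or mutually singular. -/
theorem markov_dichotomy (N : ℕ) (hN : 2 ≤ N)
    (l l' : Fin N → ℝ) (T T' : ℕ → Matrix (Fin N) (Fin N) ℝ)
    (hl : ∀ i, 0 < l i) (hlsum : ∑ i, l i = 1)
    (hpos : ∀ n i j, 0 < T n i j) (hstoch : ∀ n i, ∑ j, T n i j = 1)
    (hfix : ∀ j, ∑ i, l i * T 0 i j = l j)
    (hl' : ∀ i, 0 < l' i) (hlsum' : ∑ i, l' i = 1)
    (hpos' : ∀ n i j, 0 < T' n i j) (hstoch' : ∀ n i, ∑ j, T' n i j = 1)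
    (hfix' : ∀ j, ∑ i, l' i * T' 0 i j = l' j)
    (μ μ' : Measure (ℕ → Fin N)) [IsProbabilityMeasure μ] [IsProbabilityMeasure μ']
    (hμ : IsMarkov μ l T) (hμ' : IsMarkov μ' l' T')
    (hqs : ∀ x : ℕ → Fin N,
      Summable fun n => |T n (x n) (x (n + 1)) / T (n + 1) (x n) (x (n + 1)) - 1|)
    (hqs' : ∀ x : ℕ → Fin N,
      Summable fun n => |T' n (x n) (x (n + 1)) / T' (n + 1) (x n) (x (n + 1)) - 1|)
    :
    (μ ≪ μ' ∧ μ' ≪ μ) ∨ μ ⟂ₘ μ' := by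
  have hle := entry_le_one_of_row_sum hpos hstoch
  have hle' := entry_le_one_of_row_sum hpos' hstoch'
  obtain ⟨δ, hδ₀, hδ⟩ := exists_pos_le_of_quasiStationary hpos hqs
  obtain ⟨δ', hδ₀', hδ'⟩ := exists_pos_le_of_quasiStationary hpos' hqs'
  rcases hμ.absolutelyContinuous_or_mutuallySingular hμ' hl hpos hle hδ₀ hδ
    hl' hpos' hle' hδ₀' hδ' with h | h
  · rcases hμ'.absolutelyContinuous_or_mutuallySingular hμ hl' hpos' hle' hδ₀' hδ'
      hl hpos hle hδ₀ hδ with h' | h'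
    · exact Or.inl ⟨h, h'⟩
    · exact Or.inr h'.symm
  · exact Or.inr h
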